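/- arXiv:1410.8144 — 3 statements merged into one kernel-verified Lean document; each statement's English description precedes it below -/
import Mathlib

section
/- Let 1 < a ≤ b ≤ c ≤ ab. Then the Kronecker cone C(a,b,c) is maximal-dimensional: the ℝ-linear span of C(a,b,c) equals the subspace {(x,y,w) ∈ ℝ^a × ℝ^b × ℝ^c : Σ_i x_i = Σ_j y_j = Σ_k w_k}, which has dimension a + b + c − 2. -/
open scoped BigOperators

noncomputable section

/-- The reduced density matrix on the first subsystem. -/
def rhoA {a b c : ℕ} (ψ : Fin a × Fin b × Fin c → ℂ) : Matrix (Fin a) (Fin a) ℂ :=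
  Matrix.of fun i i' => ∑ j : Fin b, ∑ k : Fin c, ψ (i, j, k) * (starRingEnd ℂ) (ψ (i', j, k))

/-- The reduced density matrix on the second subsystem. -/
def rhoB {a b c : ℕ} (ψ : Fin a × Fin b × Fin c → ℂ) : Matrix (Fin b) (Fin b) ℂ :=
  Matrix.of fun j j' => ∑ i : Fin a, ∑ k : Fin c, ψ (i, j, k) * (starRingEnd ℂ) (ψ (i, j', k))

/-- The reduced density matrix on the third subsystem. -/
def rhoC {a b c : ℕ} (ψ : Fin a × Fin b × Fin c → ℂ) : Matrix (Fin c) (Fin c) ℂ :=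
  Matrix.of fun k k' => ∑ i : Fin a, ∑ j : Fin b, ψ (i, j, k) * (starRingEnd ℂ) (ψ (i, j, k'))

/-- `lam` is the vector of eigenvalues of `ρ`, listed in nonincreasing order
with multiplicity. -/
def IsSpecDown {n : ℕ} (ρ : Matrix (Fin n) (Fin n) ℂ) (lam : Fin n → ℝ) : Prop :=
  Antitone lam ∧ ∃ (hρ : ρ.IsHermitian) (σ : Equiv.Perm (Fin n)), lam = hρ.eigenvalues ∘ σ

/-- The Kronecker cone `C(a,b,c)`. -/
def KronCone (a b c : ℕ) : Set ((Fin a → ℝ) × (Fin b → ℝ) × (Fin c → ℝ)) :=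
  { lam | ∃ ψ : Fin a × Fin b × Fin c → ℂ,
      IsSpecDown (rhoA ψ) lam.1 ∧ IsSpecDown (rhoB ψ) lam.2.1 ∧ IsSpecDown (rhoC ψ) lam.2.2 }

/-- The pairing `⟨(H,z), λ⟩`. -/
def wtPair {a b c : ℕ} (HA : Fin a → ℝ) (HB : Fin b → ℝ) (HC : Fin c → ℝ) (z : ℝ)
    (lam : (Fin a → ℝ) × (Fin b → ℝ) × (Fin c → ℝ)) : ℝ :=
  (∑ i, HA i * lam.1 i) + (∑ j, HB j * lam.2.1 j) + (∑ k, HC k * lam.2.2 k)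
    + z * ∑ i, lam.1 i

/-- `H = (H_A, H_B, H_C)` is traceless. -/
def Traceless {a b c : ℕ} (HA : Fin a → ℝ) (HB : Fin b → ℝ) (HC : Fin c → ℝ) : Prop :=
  (∑ i, HA i) = 0 ∧ (∑ j, HB j) = 0 ∧ (∑ k, HC k) = 0

/-- `(H, z)` is a facet normal of the Kronecker cone `C(a,b,c)`. -/
def IsFacetNormal (a b c : ℕ) (HA : Fin a → ℝ) (HB : Fin b → ℝ) (HC : Fin c → ℝ)
    (z : ℝ) : Prop :=
  Traceless HA HB HC ∧ ¬(HA = 0 ∧ HB = 0 ∧ HC = 0 ∧ z = 0) ∧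
  (∀ lam ∈ KronCone a b c, 0 ≤ wtPair HA HB HC z lam) ∧
  Module.finrank ℝ
    (affineSpan ℝ {lam ∈ KronCone a b c | wtPair HA HB HC z lam = 0}).direction
    = a + b + c - 3

/-- `(H, z)` is a trivial (Weyl chamber) normal. -/
def IsTrivialNormal {a b c : ℕ} (HA : Fin a → ℝ) (HB : Fin b → ℝ) (HC : Fin c → ℝ)
    (z : ℝ) : Prop :=
  ∃ t : ℝ, 0 < t ∧
    ((∃ i i' : Fin a, i < i' ∧ HA = t • (Pi.single i 1 - Pi.single i' 1) ∧
        HB = 0 ∧ HC = 0 ∧ z = 0) ∨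
     (∃ j j' : Fin b, j < j' ∧ HB = t • (Pi.single j 1 - Pi.single j' 1) ∧
        HA = 0 ∧ HC = 0 ∧ z = 0) ∨
     (∃ k k' : Fin c, k < k' ∧ HC = t • (Pi.single k 1 - Pi.single k' 1) ∧
        HA = 0 ∧ HB = 0 ∧ z = 0))

/-- The subspace of vectors supported on coordinates satisfying `P`. -/
def suppSubmodule {ι : Type*} (P : ι → Prop) : Submodule ℂ (ι → ℂ) where
  carrier := {ψ | ∀ p, ¬ P p → ψ p = 0}
  add_mem' := by
    intro x y hx hy p hp
    simp only [Pi.add_apply, hx p hp, hy p hp, add_zero]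
  zero_mem' := by intro p _; rfl
  smul_mem' := by
    intro r x hx p hp
    simp only [Pi.smul_apply, hx p hp, smul_zero]

/-- The zero-weight space `ℋ₀(H,z)`. -/
def weight0Space {a b c : ℕ} (HA : Fin a → ℝ) (HB : Fin b → ℝ) (HC : Fin c → ℝ)
    (z : ℝ) : Submodule ℂ (Fin a × Fin b × Fin c → ℂ) :=
  suppSubmodule fun p => HA p.1 + HB p.2.1 + HC p.2.2 + z = 0

/-- The negative-weight space `ℋ₋(H,z)`. -/
def weightNegSpace {a b c : ℕ} (HA : Fin a → ℝ) (HB : Fin b → ℝ) (HC : Fin c → ℝ)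
    (z : ℝ) : Submodule ℂ (Fin a × Fin b × Fin c → ℂ) :=
  suppSubmodule fun p => HA p.1 + HB p.2.1 + HC p.2.2 + z < 0

/-- Strictly lower triangular matrices `X` with `X i' i = 0` unless
`i < i'` and `Hv i' < Hv i`. -/
def lowerMod {d : ℕ} (Hv : Fin d → ℝ) : Submodule ℂ (Matrix (Fin d) (Fin d) ℂ) where
  carrier := {X | ∀ i' i, ¬ (i < i' ∧ Hv i' < Hv i) → X i' i = 0}
  add_mem' := by
    intro X Y hX hY i' i h
    simp only [Matrix.add_apply, hX i' i h, hY i' i h, add_zero]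
  zero_mem' := by intro i' i h; rfl
  smul_mem' := by
    intro r X hX i' i h
    simp only [Matrix.smul_apply, hX i' i h, smul_zero]

/-- The nilpotent algebra `𝔫₋(H)`. -/
def nMinusMod {a b c : ℕ} (HA : Fin a → ℝ) (HB : Fin b → ℝ) (HC : Fin c → ℝ) :
    Submodule ℂ (Matrix (Fin a) (Fin a) ℂ × Matrix (Fin b) (Fin b) ℂ ×
      Matrix (Fin c) (Fin c) ℂ) :=
  (lowerMod HA).prod ((lowerMod HB).prod (lowerMod HC))

/-- The infinitesimal action `(X,Y,Z) ↦ (X⊗I⊗I + I⊗Y⊗I + I⊗I⊗Z)ψ`. -/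
def act {a b c : ℕ}
    (t : Matrix (Fin a) (Fin a) ℂ × Matrix (Fin b) (Fin b) ℂ × Matrix (Fin c) (Fin c) ℂ)
    (ψ : Fin a × Fin b × Fin c → ℂ) : Fin a × Fin b × Fin c → ℂ := fun p =>
  (∑ i', t.1 p.1 i' * ψ (i', p.2.1, p.2.2)) +
  (∑ j', t.2.1 p.2.1 j' * ψ (p.1, j', p.2.2)) +
  (∑ k', t.2.2 p.2.2 k' * ψ (p.1, p.2.1, k'))

/-- The action as a linear map in `(X,Y,Z)`. -/
def actL {a b c : ℕ} (ψ : Fin a × Fin b × Fin c → ℂ) :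
    (Matrix (Fin a) (Fin a) ℂ × Matrix (Fin b) (Fin b) ℂ × Matrix (Fin c) (Fin c) ℂ)
      →ₗ[ℂ] (Fin a × Fin b × Fin c → ℂ) where
  toFun t := act t ψ
  map_add' t s := by
    funext p
    simp only [act, Prod.fst_add, Prod.snd_add, Matrix.add_apply, add_mul,
      Finset.sum_add_distrib, Pi.add_apply]
    ring
  map_smul' r t := by
    funext p
    simp only [act, Prod.smul_fst, Prod.smul_snd, Matrix.smul_apply, smul_eq_mul,
      Pi.smul_apply, RingHom.id_apply, Finset.mul_sum, mul_assoc, mul_add]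

/-- The tangent map `T_ψ : 𝔫₋(H) → ℋ₋(H,z)` is a linear isomorphism. -/
def TangentIso {a b c : ℕ} (HA : Fin a → ℝ) (HB : Fin b → ℝ) (HC : Fin c → ℝ)
    (z : ℝ) (ψ : Fin a × Fin b × Fin c → ℂ) : Prop :=
  ∃ h : ∀ t ∈ nMinusMod HA HB HC, actL ψ t ∈ weightNegSpace HA HB HC z,
    Function.Bijective ((actL ψ).restrict h)

/-- The tangent map `T_ψ : 𝔫₋(H) → ℋ₋(H,z)` is surjective. -/
def TangentSurj {a b c : ℕ} (HA : Fin a → ℝ) (HB : Fin b → ℝ) (HC : Fin c → ℝ)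
    (z : ℝ) (ψ : Fin a × Fin b × Fin c → ℂ) : Prop :=
  ∃ h : ∀ t ∈ nMinusMod HA HB HC, actL ψ t ∈ weightNegSpace HA HB HC z,
    Function.Surjective ((actL ψ).restrict h)

/-- `(H,z)` is admissible: the hyperplane `⟨(H,z), ·⟩ = 0` in `V` is spanned by
the weights of zero `(H,z)`-weight. -/
def Admissible {a b c : ℕ} (HA : Fin a → ℝ) (HB : Fin b → ℝ) (HC : Fin c → ℝ)
    (z : ℝ) : Prop :=
  (Submodule.span ℝ
    { w : (Fin a → ℝ) × (Fin b → ℝ) × (Fin c → ℝ) |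
      ∃ i j k, HA i + HB j + HC k + z = 0 ∧
        w = (Pi.single i 1, Pi.single j 1, Pi.single k 1) } : Set _)
  = { lam | (∑ i, lam.1 i) = (∑ j, lam.2.1 j) ∧ (∑ i, lam.1 i) = (∑ k, lam.2.2 k) ∧
        wtPair HA HB HC z lam = 0 }

/-- `(H,z)` is a Ressayre element. -/
def IsRessayre {a b c : ℕ} (HA : Fin a → ℝ) (HB : Fin b → ℝ) (HC : Fin c → ℝ)
    (z : ℝ) : Prop :=
  Traceless HA HB HC ∧ ¬(HA = 0 ∧ HB = 0 ∧ HC = 0 ∧ z = 0) ∧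
  Admissible HA HB HC z ∧
  ∃ ψ ∈ weight0Space HA HB HC z, TangentIso HA HB HC z ψ

/-- `(H_A, H_B)` satisfies the extremal-edge condition. -/
def ExtremalEdge {a b : ℕ} (HA : Fin a → ℝ) (HB : Fin b → ℝ) : Prop :=
  (∑ i, HA i) = 0 ∧ (∑ j, HB j) = 0 ∧ ¬(HA = 0 ∧ HB = 0) ∧
  ∀ (x : Fin a → ℝ) (y : Fin b → ℝ), (∑ i, x i) = 0 → (∑ j, y j) = 0 →
    (∀ i j k l, HA i + HB j = HA k + HB l → x i + y j = x k + y l) →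
    ∃ t : ℝ, x = t • HA ∧ y = t • HB

theorem exists_perm_eq_comp_of_map_univ_eq {ι α : Type*} [Fintype ι] [DecidableEq α] {f g : ι → α}
    (h : Finset.univ.val.map f = Finset.univ.val.map g) :
    ∃ σ : Equiv.Perm ι, f = g ∘ σ := by
  have e : ∀ x, Nonempty ({i // f i = x} ≃ {i // g i = x}) := by
    intro x
    rw [← Fintype.card_eq, Fintype.card_subtype, Fintype.card_subtype]
    have := congrArg (Multiset.count x) h
    rw [Multiset.count_map, Multiset.count_map] at this
    simpa [Finset.card, eq_comm] using this
  refine ⟨Equiv.ofFiberEquiv fun x => (e x).some, ?_⟩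
  funext i
  exact (Equiv.ofFiberEquiv_map (fun x => (e x).some) i).symm

theorem isSpecDown_diagonal {n : ℕ} {d : Fin n → ℝ} (hd : Antitone d) :
    IsSpecDown (Matrix.diagonal fun i => (d i : ℂ)) d := by
  have hH : (Matrix.diagonal fun i => (d i : ℂ)).IsHermitian :=
    Matrix.isHermitian_diagonal_of_self_adjoint _ (by ext i; simp)
  refine ⟨hd, hH, exists_perm_eq_comp_of_map_univ_eq ?_⟩
  have h := hH.roots_charpoly_eq_eigenvalues
  rw [Matrix.charpoly_diagonal, Polynomial.roots_prod _ _
    (by simp [Finset.prod_ne_zero_iff, Polynomial.X_sub_C_ne_zero])] at h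
  have h' := congrArg (Multiset.map Complex.re) h
  simpa [Multiset.map_map, Function.comp_def] using h'

/-- The number of indices that `f` sends to `p`. -/
def fiberCard {M P : Type*} [Fintype M] [DecidableEq P] (f : M → P) (p : P) : ℕ :=
  (Finset.univ.filter fun m => f m = p).card

theorem sum_mul_conj_indicator {M P Q : Type*} [Fintype M] [Fintype Q]
    [DecidableEq P] [DecidableEq Q] (f : M → P) {g : M → Q} (hg : Function.Injective g) (p p' : P) :
    ∑ q, (∑ m, if f m = p ∧ g m = q then (1 : ℂ) else 0) *
      (starRingEnd ℂ) (∑ m, if f m = p' ∧ g m = q then (1 : ℂ) else 0) =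
    Matrix.diagonal (fun p => (fiberCard f p : ℂ)) p p' := by
  classical
  have key : ∀ m m' : M, ∑ q, (if f m = p ∧ g m = q then (1 : ℂ) else 0) *
      (if f m' = p' ∧ g m' = q then (1 : ℂ) else 0) =
      if m = m' then (if f m = p ∧ f m = p' then 1 else 0) else 0 := by
    intro m m'
    rw [Finset.sum_eq_single (g m)]
    · by_cases hm : m = m'
      · subst hm
        by_cases h1 : f m = p <;> by_cases h2 : f m = p' <;> simp [h1, h2]
      · have hgm : g m' ≠ g m := fun h => hm (hg h).symm
        simp [hm, hgm]
    · intro q _ hq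
      simp [hq.symm]
    · simp
  simp only [map_sum, apply_ite (starRingEnd ℂ), map_one, map_zero, Finset.sum_mul_sum]
  rw [Finset.sum_comm]
  simp_rw [Finset.sum_comm (s := (Finset.univ : Finset Q)), key]
  simp only [Finset.sum_ite_eq, Finset.mem_univ, if_true]
  by_cases hp : p = p'
  · subst hp
    simp [fiberCard]
  · rw [Matrix.diagonal_apply_ne _ hp]
    refine Finset.sum_eq_zero fun m _ => if_neg ?_
    rintro ⟨rfl, h⟩
    exact hp h

/-- The weight of the standard basis vector `e_i ⊗ e_j ⊗ e_k`. -/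
def weightVec {a b c : ℕ} (i : Fin a) (j : Fin b) (k : Fin c) :
    (Fin a → ℝ) × (Fin b → ℝ) × (Fin c → ℝ) :=
  (Pi.single i 1, Pi.single j 1, Pi.single k 1)

theorem sum_single_eq_fiberCard {M P : Type*} [Fintype M] [DecidableEq P] (f : M → P) :
    ∑ m, (Pi.single (f m) 1 : P → ℝ) = fun p => (fiberCard f p : ℝ) := by
  funext p
  simp [fiberCard, Pi.single_apply, Finset.sum_apply, eq_comm]

theorem isSpecDown_of_eq_diagonal_fiberCard {M : Type*} [Fintype M] {d : ℕ} {f : M → Fin d}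
    {ρ : Matrix (Fin d) (Fin d) ℂ} (hf : Antitone (fiberCard f))
    (hρ : ρ = Matrix.diagonal fun p => (fiberCard f p : ℂ)) :
    IsSpecDown ρ (∑ m, Pi.single (f m) 1) := by
  rw [sum_single_eq_fiberCard, hρ]
  have := isSpecDown_diagonal (d := fun p => (fiberCard f p : ℝ))
    fun i j hij => Nat.cast_le.mpr (hf hij)
  simpa using this

/-- A uniform superposition of basis vectors, any two of which differ in at least two tensor
factors, has diagonal reduced density matrices. -/
theorem sum_weightVec_mem_kronCone {M : Type*} [Fintype M] {a b c : ℕ}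
    {f : M → Fin a} {g : M → Fin b} {h : M → Fin c}
    (hgh : Function.Injective fun m => (g m, h m)) (hfh : Function.Injective fun m => (f m, h m))
    (hfg : Function.Injective fun m => (f m, g m)) (hf : Antitone (fiberCard f))
    (hg : Antitone (fiberCard g)) (hh : Antitone (fiberCard h)) :
    ∑ m, weightVec (f m) (g m) (h m) ∈ KronCone a b c := by
  refine ⟨fun p => ∑ m, if f m = p.1 ∧ g m = p.2.1 ∧ h m = p.2.2 then 1 else 0, ?_, ?_, ?_⟩
  · rw [Prod.fst_sum]
    refine isSpecDown_of_eq_diagonal_fiberCard hf ?_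
    ext i i'
    rw [← sum_mul_conj_indicator f hgh, Fintype.sum_prod_type]
    simp [rhoA]
  · rw [Prod.snd_sum, Prod.fst_sum]
    refine isSpecDown_of_eq_diagonal_fiberCard hg ?_
    ext j j'
    rw [← sum_mul_conj_indicator g hfh, Fintype.sum_prod_type]
    simp [rhoB, and_left_comm]
  · rw [Prod.snd_sum, Prod.snd_sum]
    refine isSpecDown_of_eq_diagonal_fiberCard hh ?_
    ext k k'
    rw [← sum_mul_conj_indicator h hfg, Fintype.sum_prod_type]
    simp [rhoC, and_comm (a := h _ = _), and_assoc]

theorem antitone_fiberCard_of_shift {n d : ℕ} {u : ℕ → ℕ} (hu : ∀ m : Fin n, u m < d)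
    (H : ∀ i i', i < i' → ∃ t, ∀ m < n, u m = i' → t ≤ m ∧ u (m - t) = i) :
    Antitone (fiberCard fun m : Fin n => (⟨u m, hu m⟩ : Fin d)) := by
  intro i i' hii
  rcases hii.eq_or_lt with rfl | hlt
  · exact le_rfl
  obtain ⟨t, ht⟩ := H i i' hlt
  refine Finset.card_le_card_of_injOn
    (fun m : Fin n => (⟨m - t, (Nat.sub_le _ _).trans_lt m.2⟩ : Fin n)) ?_ ?_
  · intro m hm
    simp only [Finset.coe_filter, Finset.mem_univ, true_and, Set.mem_ofPred_eq, Fin.ext_iff] at hm ⊢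
    exact (ht m m.2 hm).2
  · intro m hm m' hm' hmm
    simp only [Finset.coe_filter, Finset.mem_univ, true_and, Set.mem_ofPred_eq, Fin.ext_iff]
      at hm hm' hmm ⊢
    have h1 := (ht m m.2 hm).1
    have h2 := (ht m' m'.2 hm').1
    omega

theorem sum_weightVec_mem_kronCone_of_shift {n a b c : ℕ} {u v w : ℕ → ℕ}
    (hu : ∀ m : Fin n, u m < a) (hv : ∀ m : Fin n, v m < b) (hw : ∀ m : Fin n, w m < c)
    (hvw : ∀ m < n, ∀ m' < n, v m = v m' → w m = w m' → m = m')
    (huw : ∀ m < n, ∀ m' < n, u m = u m' → w m = w m' → m = m')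
    (huv : ∀ m < n, ∀ m' < n, u m = u m' → v m = v m' → m = m')
    (Hu : ∀ i i', i < i' → ∃ t, ∀ m < n, u m = i' → t ≤ m ∧ u (m - t) = i)
    (Hv : ∀ i i', i < i' → ∃ t, ∀ m < n, v m = i' → t ≤ m ∧ v (m - t) = i)
    (Hw : ∀ i i', i < i' → ∃ t, ∀ m < n, w m = i' → t ≤ m ∧ w (m - t) = i) :
    ∑ m : Fin n, weightVec (⟨u m, hu m⟩ : Fin a) (⟨v m, hv m⟩ : Fin b) (⟨w m, hw m⟩ : Fin c) ∈
      KronCone a b c := by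
  refine sum_weightVec_mem_kronCone ?_ ?_ ?_ (antitone_fiberCard_of_shift hu Hu)
    (antitone_fiberCard_of_shift hv Hv) (antitone_fiberCard_of_shift hw Hw)
  · intro m m' h
    simp only [Prod.mk.injEq, Fin.mk.injEq] at h
    exact Fin.ext (hvw m m.2 m' m'.2 h.1 h.2)
  · intro m m' h
    simp only [Prod.mk.injEq, Fin.mk.injEq] at h
    exact Fin.ext (huw m m.2 m' m'.2 h.1 h.2)
  · intro m m' h
    simp only [Prod.mk.injEq, Fin.mk.injEq] at h
    exact Fin.ext (huv m m.2 m' m'.2 h.1 h.2)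

theorem sum_lex_mem_kronCone {n a b c : ℕ} (hb : 0 < b) (hbc : n ≤ c) (hn : n ≤ a * b) :
    ∑ m : Fin n, weightVec (⟨m / b, Nat.div_lt_of_lt_mul (by
      rw [mul_comm]; exact m.2.trans_le hn)⟩ : Fin a)
      (⟨m % b, Nat.mod_lt _ hb⟩ : Fin b) (⟨m, m.2.trans_le hbc⟩ : Fin c) ∈ KronCone a b c := by
  refine sum_weightVec_mem_kronCone_of_shift (u := fun m => m / b) (v := fun m => m % b)
    (w := fun m => m) _ _ _ (fun _ _ _ _ _ h => h) (fun _ _ _ _ _ h => h) ?_ ?_ ?_ ?_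
  · intro m _ m' _ h1 h2
    rw [← Nat.div_add_mod m b, ← Nat.div_add_mod m' b, h1, h2]
  · intro i i' hi
    refine ⟨b * (i' - i), fun m _ hm => ?_⟩
    have h1 : b * i' ≤ m := hm ▸ Nat.mul_div_le m b
    have h2 : b * (i' - i) ≤ b * i' := Nat.mul_le_mul_left _ (Nat.sub_le _ _)
    refine ⟨h2.trans h1, ?_⟩
    rw [Nat.sub_mul_div, hm]
    omega
  · intro j j' hj
    refine ⟨j' - j, fun m _ hm => ?_⟩
    have h1 := Nat.mod_le m b
    have h2 := Nat.mod_lt m hb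
    refine ⟨by omega, ?_⟩
    have h3 : m - (j' - j) = j + b * (m / b) := by
      have := Nat.div_add_mod m b
      omega
    rw [h3, Nat.add_mul_mod_self_left, Nat.mod_eq_of_lt (by omega)]
  · intro k k' hk
    refine ⟨k' - k, fun m _ hm => ?_⟩
    omega

theorem weightVec_lex_mem_span {a b c k : ℕ} (hb : 0 < b) (hcab : c ≤ a * b) (hk : k < c)
    (hka : k / b < a) :
    weightVec (⟨k / b, hka⟩ : Fin a) (⟨k % b, Nat.mod_lt _ hb⟩ : Fin b) (⟨k, hk⟩ : Fin c) ∈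
      Submodule.span ℝ (KronCone a b c) := by
  have h1 := Submodule.subset_span (R := ℝ)
    (sum_lex_mem_kronCone (n := k + 1) (a := a) hb hk (by omega))
  have h0 := Submodule.subset_span (R := ℝ)
    (sum_lex_mem_kronCone (n := k) (a := a) hb hk.le (by omega))
  rw [Fin.sum_univ_castSucc] at h1
  simpa using Submodule.sub_mem _ h1 h0

theorem sum_diag_mem_kronCone {n a b c : ℕ} (ha : n ≤ a) (hb : n ≤ b) (hc : 0 < c) :
    ∑ m : Fin n, weightVec (⟨m, m.2.trans_le ha⟩ : Fin a) (⟨m, m.2.trans_le hb⟩ : Fin b)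
      (⟨0, hc⟩ : Fin c) ∈ KronCone a b c := by
  refine sum_weightVec_mem_kronCone_of_shift (u := fun m => m) (v := fun m => m)
    (w := fun _ => 0) _ _ _ (fun _ _ _ _ h _ => h) (fun _ _ _ _ h _ => h)
    (fun _ _ _ _ h _ => h) ?_ ?_ ?_
  · exact fun i i' hi => ⟨i' - i, fun m _ hm => by omega⟩
  · exact fun i i' hi => ⟨i' - i, fun m _ hm => by omega⟩
  · exact fun i i' hi => ⟨0, fun m _ hm => by omega⟩

theorem weightVec_diag_mem_span {a b c i : ℕ} (ha : i < a) (hb : i < b) (hc : 0 < c) :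
    weightVec (⟨i, ha⟩ : Fin a) (⟨i, hb⟩ : Fin b) (⟨0, hc⟩ : Fin c) ∈
      Submodule.span ℝ (KronCone a b c) := by
  have h1 := Submodule.subset_span (R := ℝ) (sum_diag_mem_kronCone (n := i + 1) ha hb hc)
  have h0 := Submodule.subset_span (R := ℝ) (sum_diag_mem_kronCone (n := i) ha.le hb.le hc)
  rw [Fin.sum_univ_castSucc] at h1
  simpa using Submodule.sub_mem _ h1 h0

theorem weightVec_one_zero_one_mem_span {a b c : ℕ} (ha : 1 < a) (hb : 0 < b) (hc : 1 < c)
    (h0 : weightVec (⟨0, by omega⟩ : Fin a) (⟨0, hb⟩ : Fin b) (⟨0, by omega⟩ : Fin c) ∈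
      Submodule.span ℝ (KronCone a b c)) :
    weightVec (⟨1, ha⟩ : Fin a) (⟨0, hb⟩ : Fin b) (⟨1, hc⟩ : Fin c) ∈
      Submodule.span ℝ (KronCone a b c) := by
  have h1 := Submodule.subset_span (R := ℝ)
    (sum_weightVec_mem_kronCone_of_shift (n := 2) (u := fun m => m) (v := fun _ => 0)
      (w := fun m => m) (a := a) (b := b) (c := c) (fun m => by omega) (fun m => hb)
      (fun m => by omega) (fun _ _ _ _ _ h => h) (fun _ _ _ _ _ h => h) (fun _ _ _ _ h _ => h)
      (fun i i' hi => ⟨i' - i, fun m _ hm => by omega⟩)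
      (fun i i' hi => ⟨0, fun m _ hm => by omega⟩)
      (fun i i' hi => ⟨i' - i, fun m _ hm => by omega⟩))
  rw [Fin.sum_univ_two] at h1
  simpa using Submodule.sub_mem _ h1 h0

theorem weightVec_one_mem_span {a b c j : ℕ} (ha : 1 < a) (hj : 0 < j) (hb : j < b) (hbc : b ≤ c)
    (hcab : c ≤ a * b) :
    weightVec (⟨1, ha⟩ : Fin a) (⟨j, hb⟩ : Fin b) (⟨0, by omega⟩ : Fin c) ∈
      Submodule.span ℝ (KronCone a b c) := by
  have h1 := Submodule.subset_span (R := ℝ)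
    (sum_weightVec_mem_kronCone_of_shift (n := j + 1) (u := fun m => if m < j then 0 else 1)
      (v := fun m => m) (w := fun m => if m < j then m else 0) (a := a) (b := b) (c := c)
      (fun m => by split_ifs <;> omega) (fun m => by omega)
      (fun m => by split_ifs <;> omega) (fun _ _ _ _ h _ => h)
      (fun m _ m' _ h1 h2 => by split_ifs at h1 h2 <;> omega) (fun _ _ _ _ _ h => h)
      (fun i i' hi => ⟨j, fun m _ => by split_ifs <;> omega⟩)
      (fun i i' hi => ⟨i' - i, fun m _ => by omega⟩)
      (fun i i' hi => ⟨i' - i, fun m _ => by split_ifs <;> omega⟩))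
  have h0 := Submodule.subset_span (R := ℝ)
    (sum_lex_mem_kronCone (n := j) (a := a) (b := b) (c := c) (by omega) (by omega) (by omega))
  rw [Fin.sum_univ_castSucc] at h1
  have h2 := Submodule.sub_mem _ h1 h0
  have e1 : ∀ m : Fin j, (m : ℕ) / b = 0 := fun m => Nat.div_eq_of_lt (by omega)
  have e2 : ∀ m : Fin j, (m : ℕ) % b = m := fun m => Nat.mod_eq_of_lt (by omega)
  simpa [e1, e2] using h2

theorem mem_span_kronCone {a b c : ℕ} (ha : 1 < a) (hab : a ≤ b) (hbc : b ≤ c) (hcab : c ≤ a * b)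
    {lam : (Fin a → ℝ) × (Fin b → ℝ) × (Fin c → ℝ)} (h1 : ∑ i, lam.1 i = ∑ j, lam.2.1 j)
    (h2 : ∑ i, lam.1 i = ∑ k, lam.2.2 k) : lam ∈ Submodule.span ℝ (KronCone a b c) := by
  set W := Submodule.span ℝ (KronCone a b c)
  let i₀ : Fin a := ⟨0, by omega⟩
  let i₁ : Fin a := ⟨1, ha⟩
  let j₀ : Fin b := ⟨0, by omega⟩
  let j₁ : Fin b := ⟨1, by omega⟩
  let k₀ : Fin c := ⟨0, by omega⟩
  let k₁ : Fin c := ⟨1, by omega⟩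
  let A : Fin a → (Fin a → ℝ) × (Fin b → ℝ) × (Fin c → ℝ) :=
    fun i => (Pi.single i 1 - Pi.single i₀ 1, 0, 0)
  let B : Fin b → (Fin a → ℝ) × (Fin b → ℝ) × (Fin c → ℝ) :=
    fun j => (0, Pi.single j 1 - Pi.single j₀ 1, 0)
  let C : Fin c → (Fin a → ℝ) × (Fin b → ℝ) × (Fin c → ℝ) :=
    fun k => (0, 0, Pi.single k 1 - Pi.single k₀ 1)
  have hsplit : ∀ i j k, weightVec i j k = weightVec i₀ j₀ k₀ + A i + B j + C k := by
    intro i j k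
    simp [weightVec, A, B, C]
  have hA0 : A i₀ = 0 := by simp [A]
  have hB0 : B j₀ = 0 := by simp [B]
  have hC0 : C k₀ = 0 := by simp [C]
  have hO : weightVec i₀ j₀ k₀ ∈ W := weightVec_diag_mem_span _ _ _
  have hmem : ∀ i j k, weightVec i j k ∈ W → A i + B j + C k ∈ W := by
    intro i j k h
    have := W.sub_mem h hO
    rwa [hsplit i j k, add_assoc, add_assoc, add_sub_cancel_left, ← add_assoc] at this
  have hAB : A i₁ + B j₁ ∈ W := by
    simpa [hC0] using hmem i₁ j₁ k₀ (weightVec_diag_mem_span _ _ _)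
  have hAC : A i₁ + C k₁ ∈ W := by
    simpa [hB0] using hmem i₁ j₀ k₁ (weightVec_one_zero_one_mem_span _ _ _ hO)
  have hlex : ∀ k : Fin c, ∃ i j, A i + B j + C k ∈ W := fun k =>
    ⟨_, _, hmem _ _ _ (weightVec_lex_mem_span (by omega) hcab k.2
      (Nat.div_lt_of_lt_mul (by rw [mul_comm]; omega)))⟩
  have hBC : B j₁ + C k₁ ∈ W := by
    have h := weightVec_lex_mem_span (a := a) (b := b) (c := c) (k := 1) (by omega) hcab (by omega)
      (by rw [Nat.div_eq_of_lt (by omega)]; omega)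
    simp only [Nat.div_eq_of_lt (show 1 < b by omega), Nat.mod_eq_of_lt (show 1 < b by omega)] at h
    simpa [hA0] using hmem i₀ j₁ k₁ h
  have hA1 : A i₁ ∈ W := by
    have := W.smul_mem (1 / 2 : ℝ) (W.sub_mem (W.add_mem hAB hAC) hBC)
    convert this using 1
    module
  have hB : ∀ j, B j ∈ W := by
    intro j
    rcases Nat.eq_zero_or_pos j with hj | hj
    · have : j = j₀ := Fin.ext hj
      rw [this, hB0]
      exact W.zero_mem
    · have := hmem i₁ j k₀ (weightVec_one_mem_span ha hj j.2 hbc hcab)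
      rw [hC0, add_zero] at this
      exact (W.add_mem_iff_right hA1).mp this
  have hA : ∀ i, A i ∈ W := by
    intro i
    have := hmem i ⟨i, by omega⟩ k₀ (weightVec_diag_mem_span _ _ _)
    rw [hC0, add_zero] at this
    exact (W.add_mem_iff_left (hB _)).mp this
  have hC : ∀ k, C k ∈ W := by
    intro k
    obtain ⟨i, j, h⟩ := hlex k
    exact (W.add_mem_iff_right (W.add_mem (hA i) (hB j))).mp h
  have hlam : lam = (∑ i, lam.1 i) • weightVec i₀ j₀ k₀ + ∑ i, lam.1 i • A i
      + ∑ j, lam.2.1 j • B j + ∑ k, lam.2.2 k • C k := by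
    refine Prod.ext ?_ (Prod.ext ?_ ?_)
    · funext i
      simp [weightVec, A, B, C, Prod.fst_sum, Finset.sum_apply, mul_sub,
        Finset.sum_sub_distrib, Pi.single_apply]
    · funext j
      rw [h1]
      simp [weightVec, A, B, C, Prod.fst_sum, Prod.snd_sum, Finset.sum_apply, mul_sub,
        Finset.sum_sub_distrib, Pi.single_apply]
    · funext k
      rw [h2]
      simp [weightVec, A, B, C, Prod.snd_sum, Finset.sum_apply, mul_sub,
        Finset.sum_sub_distrib, Pi.single_apply]
  rw [hlam]
  exact W.add_mem (W.add_mem (W.add_mem (W.smul_mem _ hO)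
    (W.sum_mem fun i _ => W.smul_mem _ (hA i))) (W.sum_mem fun j _ => W.smul_mem _ (hB j)))
    (W.sum_mem fun k _ => W.smul_mem _ (hC k))

theorem IsSpecDown.sum_eq_trace {n : ℕ} {ρ : Matrix (Fin n) (Fin n) ℂ} {lam : Fin n → ℝ}
    (h : IsSpecDown ρ lam) : ((∑ i, lam i : ℝ) : ℂ) = ρ.trace := by
  obtain ⟨-, hρ, σ, rfl⟩ := h
  rw [hρ.trace_eq_sum_eigenvalues]
  simp [Equiv.sum_comp σ fun i => (hρ.eigenvalues i : ℂ)]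

theorem trace_rhoA_eq_trace_rhoB {a b c : ℕ} (ψ : Fin a × Fin b × Fin c → ℂ) :
    (rhoA ψ).trace = (rhoB ψ).trace := by
  simp only [Matrix.trace, Matrix.diag, rhoA, rhoB, Matrix.of_apply]
  exact Finset.sum_comm

theorem trace_rhoB_eq_trace_rhoC {a b c : ℕ} (ψ : Fin a × Fin b × Fin c → ℂ) :
    (rhoB ψ).trace = (rhoC ψ).trace := by
  simp only [Matrix.trace, Matrix.diag, rhoB, rhoC, Matrix.of_apply]
  rw [Finset.sum_comm, Finset.sum_comm (s := (Finset.univ : Finset (Fin c)))]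
  exact Finset.sum_congr rfl fun i _ => Finset.sum_comm

/-- The differences of the sums of the three components. -/
def sumDiff (a b c : ℕ) : ((Fin a → ℝ) × (Fin b → ℝ) × (Fin c → ℝ)) →ₗ[ℝ] ℝ × ℝ where
  toFun lam := (∑ i, lam.1 i - ∑ j, lam.2.1 j, ∑ i, lam.1 i - ∑ k, lam.2.2 k)
  map_add' x y := by
    ext <;> simp [Finset.sum_add_distrib] <;> ring
  map_smul' r x := by
    ext <;> simp [← Finset.mul_sum, mul_sub]

theorem mem_ker_sumDiff {a b c : ℕ} {lam : (Fin a → ℝ) × (Fin b → ℝ) × (Fin c → ℝ)} :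
    lam ∈ LinearMap.ker (sumDiff a b c) ↔
      (∑ i, lam.1 i) = (∑ j, lam.2.1 j) ∧ (∑ i, lam.1 i) = (∑ k, lam.2.2 k) := by
  simp [sumDiff, sub_eq_zero]

theorem finrank_ker_sumDiff {a b c : ℕ} (hb : 0 < b) (hc : 0 < c) :
    Module.finrank ℝ (LinearMap.ker (sumDiff a b c)) = a + b + c - 2 := by
  have hsurj : Function.Surjective (sumDiff a b c) := fun y =>
    ⟨(0, Pi.single ⟨0, hb⟩ (-y.1), Pi.single ⟨0, hc⟩ (-y.2)), by ext <;> simp [sumDiff]⟩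
  have h := (sumDiff a b c).finrank_range_add_finrank_ker
  rw [LinearMap.range_eq_top.mpr hsurj] at h
  simp at h
  omega

theorem span_kronCone_eq_ker_sumDiff {a b c : ℕ} (ha : 1 < a) (hab : a ≤ b) (hbc : b ≤ c)
    (hcab : c ≤ a * b) :
    Submodule.span ℝ (KronCone a b c) = LinearMap.ker (sumDiff a b c) := by
  refine le_antisymm (Submodule.span_le.mpr ?_) fun lam h => ?_
  · rintro lam ⟨ψ, hA, hB, hC⟩
    have hAB := trace_rhoA_eq_trace_rhoB ψ
    have hBC := trace_rhoB_eq_trace_rhoC ψ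
    rw [← hA.sum_eq_trace, ← hB.sum_eq_trace] at hAB
    rw [← hB.sum_eq_trace, ← hC.sum_eq_trace] at hBC
    have hAB' := Complex.ofReal_injective hAB
    have hBC' := Complex.ofReal_injective hBC
    exact mem_ker_sumDiff.mpr ⟨hAB', hAB'.trans hBC'⟩
  · obtain ⟨h1, h2⟩ := mem_ker_sumDiff.mp h
    exact mem_span_kronCone ha hab hbc hcab h1 h2

/-- the Kronecker cone is of maximal dimension. -/
theorem kronCone_maximal_dimensional (a b c : ℕ)
    (ha : 1 < a) (hab : a ≤ b) (hbc : b ≤ c) (hcab : c ≤ a * b) :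
    (Submodule.span ℝ (KronCone a b c) : Set _) =
      { lam : (Fin a → ℝ) × (Fin b → ℝ) × (Fin c → ℝ) |
        (∑ i, lam.1 i) = (∑ j, lam.2.1 j) ∧ (∑ i, lam.1 i) = (∑ k, lam.2.2 k) } ∧
    Module.finrank ℝ (Submodule.span ℝ (KronCone a b c)) = a + b + c - 2 := by
  rw [span_kronCone_eq_ker_sumDiff ha hab hbc hcab]
  exact ⟨Set.ext fun _ => mem_ker_sumDiff, finrank_ker_sumDiff (by omega) (by omega)⟩

end
end

section
/- Let 1 < a ≤ b ≤ c ≤ ab. Then there exists a complex matrix M of size c × (a·b) (with columns indexed by pairs (i,j) ∈ Fin a × Fin b) such that for all unitary matrices U_A ∈ U(a), U_B ∈ U(b), U_C ∈ U(c): if U_C · M · (U_A ⊗ U_B) = M, then U_A, U_B, and U_C are each scalar multiples of the identity matrix. -/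
open scoped BigOperators

noncomputable section

/-- A unitary matrix whose rows other than `i₀` are supported on the diagonal is diagonal. -/
lemma apply_eq_zero_of_mem_unitaryGroup {n : Type*} [Fintype n] [DecidableEq n]
    {U : Matrix n n ℂ} (hU : U ∈ Matrix.unitaryGroup n ℂ) (i₀ : n)
    (h : ∀ i, i ≠ i₀ → U i i ≠ 0 ∧ ∀ j, j ≠ i → U i j = 0) (i j : n) (hij : j ≠ i) :
    U i j = 0 := by
  by_cases hi : i = i₀
  · subst hi
    have hUU := congrFun (congrFun (Matrix.mem_unitaryGroup_iff.mp hU) i) j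
    rw [Matrix.mul_apply, Matrix.one_apply_ne hij.symm, Finset.sum_eq_single j] at hUU
    · simpa [Matrix.star_apply, (h j hij).1] using hUU
    · intro k _ hk
      simp [Matrix.star_apply, (h j hij).2 k hk]
    · simp
  · exact (h i hi).2 j hij

/-- The indicator vector of the cross `{i = 0} ∪ {j = 0}`. -/
def crossVec (a b : ℕ) [NeZero a] [NeZero b] : EuclideanSpace ℂ (Fin a × Fin b) :=
  WithLp.toLp 2 fun p => if p.1 = 0 ∨ p.2 = 0 then 1 else 0

lemma crossVec_apply {a b : ℕ} [NeZero a] [NeZero b] (p : Fin a × Fin b) :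
    crossVec a b p = if p.1 = 0 ∨ p.2 = 0 then 1 else 0 := rfl

lemma crossVec_ne_zero (a b : ℕ) [NeZero a] [NeZero b] : crossVec a b ≠ 0 := by
  intro h
  have := congrArg (fun v : EuclideanSpace ℂ (Fin a × Fin b) => v (0, 0)) h
  simp [crossVec_apply] at this

/-- An orthonormal basis containing a multiple of `crossVec` and all coordinate vectors
off the cross. -/
lemma exists_orthonormalBasis_cross (a b : ℕ) [NeZero a] [NeZero b] :
    ∃ e : OrthonormalBasis (Fin a × Fin b) ℂ (EuclideanSpace ℂ (Fin a × Fin b)),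
      (∃ r : ℂ, r ≠ 0 ∧ e (0, 0) = r • crossVec a b) ∧
      ∀ p : Fin a × Fin b, p.1 ≠ 0 → p.2 ≠ 0 → e p = EuclideanSpace.single p 1 := by
  have hw : ‖crossVec a b‖ ≠ 0 := norm_ne_zero_iff.mpr (crossVec_ne_zero a b)
  let r : ℂ := (‖crossVec a b‖ : ℂ)⁻¹
  let v : Fin a × Fin b → EuclideanSpace ℂ (Fin a × Fin b) := fun p =>
    if p = (0, 0) then r • crossVec a b else EuclideanSpace.single p 1
  let s : Set (Fin a × Fin b) := {p | p = (0, 0) ∨ (p.1 ≠ 0 ∧ p.2 ≠ 0)}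
  have hv : Orthonormal ℂ (s.domRestrict v) := by
    constructor
    · rintro ⟨p, hp⟩
      by_cases h : p = (0, 0)
      · simp [Set.domRestrict_apply, v, h, r, norm_smul, hw]
      · simp [Set.domRestrict_apply, v, h]
    · rintro ⟨p, hp⟩ ⟨q, hq⟩ hpq
      have hpq' : p ≠ q := fun h => hpq (Subtype.ext h)
      by_cases h : p = (0, 0) <;> by_cases h' : q = (0, 0)
      · exact absurd (h.trans h'.symm) hpq'
      · have := hq.resolve_left h'
        simp [Set.domRestrict_apply, v, h, h', crossVec_apply, this.1, this.2, EuclideanSpace.inner_single_right]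
      · have := hp.resolve_left h
        simp [Set.domRestrict_apply, v, h, h', crossVec_apply, this.1, this.2, EuclideanSpace.inner_single_left]
      · simp [Set.domRestrict_apply, v, h, h', EuclideanSpace.inner_single_left, hpq']
  obtain ⟨e, he⟩ := hv.exists_orthonormalBasis_extension_of_card_eq (by simp)
  refine ⟨e, ⟨r, by simpa [r] using hw, ?_⟩, fun p h₁ h₂ => ?_⟩
  · rw [he (0, 0) (Or.inl rfl)]
    simp [v]
  · have hp : p ≠ (0, 0) := fun h => h₁ (by simp [h])
    rw [he p (Or.inr ⟨h₁, h₂⟩)]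
    simp [v, hp]

/-- An injection from `Fin c` whose range contains any prescribed image of `Fin b`,
for `b ≤ c ≤ card α`. -/
lemma exists_injective_range_subset {α : Type*} [Fintype α] {b c : ℕ} (g : Fin b → α)
    (hbc : b ≤ c) (hc : c ≤ Fintype.card α) :
    ∃ f : Fin c → α, Function.Injective f ∧ ∀ j, ∃ k, f k = g j := by
  classical
  obtain ⟨t, ht, htc⟩ := Finset.exists_superset_card_eq (s := Finset.univ.image g) (n := c)
    ((Finset.card_image_le.trans (by simp)).trans hbc) hc
  let φ := (t.equivFinOfCardEq htc).symm
  refine ⟨fun k => φ k, Subtype.val_injective.comp φ.injective, fun j => ?_⟩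
  exact ⟨φ.symm ⟨g j, ht (by simp)⟩, by simp⟩

/-- If the rows of `M` are orthogonal with distinct norms, then `C * M * T = M` with `C` and `T`
unitary forces `C` to be diagonal. -/
lemma apply_eq_zero_of_mul_mul_eq {m n : Type*} [Fintype m] [DecidableEq m] [Fintype n]
    [DecidableEq n] {M : Matrix m n ℂ} {d : m → ℂ} (hd : Function.Injective d)
    (hM : M * M.conjTranspose = Matrix.diagonal d) {C : Matrix m m ℂ} {T : Matrix n n ℂ}
    (hC : C ∈ Matrix.unitaryGroup m ℂ) (hT : T ∈ Matrix.unitaryGroup n ℂ)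
    (h : C * M * T = M) {k l : m} (hkl : k ≠ l) : C k l = 0 := by
  have hTT : T * T.conjTranspose = 1 := Matrix.mem_unitaryGroup_iff.mp hT
  have hCC : C.conjTranspose * C = 1 := Matrix.mem_unitaryGroup_iff'.mp hC
  have hD : Matrix.diagonal d * C = C * Matrix.diagonal d := by
    calc Matrix.diagonal d * C
        = (C * M * T) * (C * M * T).conjTranspose * C := by rw [h, hM]
      _ = C * M * (T * T.conjTranspose) * M.conjTranspose * (C.conjTranspose * C) := by
          simp only [Matrix.conjTranspose_mul, Matrix.mul_assoc]
      _ = C * Matrix.diagonal d := by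
          rw [hTT, hCC, Matrix.mul_one, Matrix.mul_one, Matrix.mul_assoc, hM]
  have hkl' := congrFun (congrFun hD k) l
  rw [Matrix.diagonal_mul, Matrix.mul_diagonal, mul_comm, ← sub_eq_zero, ← mul_sub] at hkl'
  exact (mul_eq_zero.mp hkl').resolve_right (sub_ne_zero.mpr (hd.ne hkl))

/-- Unitary matrices `U`, `V` are scalar if `U ⊗ V` fixes, up to scalars, `crossVec` and a family
of coordinate vectors off the cross covering all nonzero indices. -/
lemma eq_smul_one_of_fixes_cross {a b : ℕ} [NeZero a] [NeZero b] {U : Matrix (Fin a) (Fin a) ℂ}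
    {V : Matrix (Fin b) (Fin b) ℂ} (hU : U ∈ Matrix.unitaryGroup (Fin a) ℂ)
    (hV : V ∈ Matrix.unitaryGroup (Fin b) ℂ)
    (hi : ∀ i, i ≠ 0 → ∃ j, ∃ d : ℂ, ∀ i' j',
      d * (U i i' * V j j') = if (i', j') = (i, j) then 1 else 0)
    (hj : ∀ j, j ≠ 0 → ∃ i, ∃ d : ℂ, ∀ i' j',
      d * (U i i' * V j j') = if (i', j') = (i, j) then 1 else 0)
    {d : ℂ} (hw : ∀ q, d * ∑ p, crossVec a b p * (U p.1 q.1 * V p.2 q.2) = crossVec a b q) :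
    U = U 0 0 • 1 ∧ V = V 0 0 • 1 := by
  have hU' : ∀ i i', i' ≠ i → U i i' = 0 := by
    refine apply_eq_zero_of_mem_unitaryGroup hU 0 fun i h => ?_
    obtain ⟨j, d, hd⟩ := hi i h
    have h1 : d * (U i i * V j j) ≠ 0 := by simp [hd i j]
    simp only [ne_eq, mul_eq_zero, not_or] at h1
    refine ⟨h1.2.1, fun i' hi' => ?_⟩
    have := hd i' j
    simpa [hi', h1.1, h1.2.2] using this
  have hV' : ∀ j j', j' ≠ j → V j j' = 0 := by
    refine apply_eq_zero_of_mem_unitaryGroup hV 0 fun j h => ?_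
    obtain ⟨i, d, hd⟩ := hj j h
    have h1 : d * (U i i * V j j) ≠ 0 := by simp [hd i j]
    simp only [ne_eq, mul_eq_zero, not_or] at h1
    refine ⟨h1.2.2, fun j' hj' => ?_⟩
    have := hd i j'
    simpa [hj', h1.1, h1.2.1] using this
  have hcross : ∀ q : Fin a × Fin b, q.1 = 0 ∨ q.2 = 0 → d * (U q.1 q.1 * V q.2 q.2) = 1 := by
    intro q hq
    have := hw q
    rw [Finset.sum_eq_single q] at this
    · simpa [crossVec_apply, hq] using this
    · intro p _ hp
      by_cases h1 : q.1 = p.1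
      · rw [hV' p.2 q.2 fun h2 => hp (Prod.ext h1.symm h2.symm)]
        simp
      · rw [hU' _ _ h1]
        simp
    · simp
  have h00 := hcross (0, 0) (Or.inl rfl)
  have hne : d * (U 0 0 * V 0 0) ≠ 0 := by rw [h00]; exact one_ne_zero
  simp only [ne_eq, mul_eq_zero, not_or] at hne
  constructor
  · ext i i'
    by_cases h : i' = i
    · subst h
      have := mul_left_cancel₀ hne.1 ((hcross (i', 0) (Or.inr rfl)).trans h00.symm)
      simpa using mul_right_cancel₀ hne.2.2 this
    · simp [hU' i i' h, Matrix.one_apply_ne' h]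
  · ext j j'
    by_cases h : j' = j
    · subst h
      have := mul_left_cancel₀ hne.1 ((hcross (0, j') (Or.inl rfl)).trans h00.symm)
      simpa using mul_left_cancel₀ hne.2.1 this
    · simp [hV' j j' h, Matrix.one_apply_ne' h]

/-- existence of a matrix `M : ℂ^a ⊗ ℂ^b → ℂ^c` whose unitary
stabilizer consists only of scalars. -/
theorem exists_matrix_with_scalar_stabilizer (a b c : ℕ)
    (ha : 1 < a) (hab : a ≤ b) (hbc : b ≤ c) (hcab : c ≤ a * b) :
    ∃ M : Matrix (Fin c) (Fin a × Fin b) ℂ,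
      ∀ (UA : Matrix (Fin a) (Fin a) ℂ) (UB : Matrix (Fin b) (Fin b) ℂ)
        (UC : Matrix (Fin c) (Fin c) ℂ),
        UA ∈ Matrix.unitaryGroup (Fin a) ℂ →
        UB ∈ Matrix.unitaryGroup (Fin b) ℂ →
        UC ∈ Matrix.unitaryGroup (Fin c) ℂ →
        UC * M * (Matrix.of fun p q : Fin a × Fin b => UA p.1 q.1 * UB p.2 q.2)
          = M →
        (∃ zA : ℂ, UA = zA • (1 : Matrix (Fin a) (Fin a) ℂ)) ∧
        (∃ zB : ℂ, UB = zB • (1 : Matrix (Fin b) (Fin b) ℂ)) ∧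
        (∃ zC : ℂ, UC = zC • (1 : Matrix (Fin c) (Fin c) ℂ)) := by
  have : NeZero a := ⟨by omega⟩
  have : NeZero b := ⟨by omega⟩
  obtain ⟨e, ⟨r, hr, he₀⟩, he⟩ := exists_orthonormalBasis_cross a b
  let g : Fin b → Fin a × Fin b := fun j => (⟨min j (a - 1), by omega⟩, j)
  have hg₀ : g 0 = (0, 0) := by simp [g]
  have hg : ∀ j, j ≠ 0 → (g j).1 ≠ 0 ∧ (g j).2 ≠ 0 := by
    intro j hj
    refine ⟨fun h => ?_, hj⟩
    have h1 := congrArg Fin.val h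
    have h2 : (j : ℕ) ≠ 0 := fun h => hj (Fin.ext (by simpa using h))
    simp only [g, Fin.val_zero] at h1
    omega
  obtain ⟨f, hf, hfg⟩ := exists_injective_range_subset g hbc (by simpa using hcab)
  let M : Matrix (Fin c) (Fin a × Fin b) ℂ := Matrix.of fun k p => ((k : ℂ) + 1) * e (f k) p
  refine ⟨M, fun UA UB UC hA hB hC h => ?_⟩
  have hk : ∀ k : Fin c, (k : ℂ) + 1 ≠ 0 := fun k => Nat.cast_add_one_ne_zero _
  have hinj : Function.Injective fun k : Fin c => ((k : ℂ) + 1) * ((k : ℂ) + 1) := by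
    intro k l hkl
    have : ((k : ℕ) + 1) * (k + 1) = ((l : ℕ) + 1) * (l + 1) := by
      simp only at hkl
      exact_mod_cast hkl
    have := Nat.mul_self_inj.mp this
    exact Fin.ext (by omega)
  have hMM : M * M.conjTranspose = Matrix.diagonal fun k : Fin c => ((k : ℂ) + 1) * ((k : ℂ) + 1) := by
    ext k l
    have horth := orthonormal_iff_ite.mp e.orthonormal (f l) (f k)
    rw [PiLp.inner_apply] at horth
    calc (M * M.conjTranspose) k l
        = ((k : ℂ) + 1) * ((l : ℂ) + 1) * ∑ p, inner ℂ (e (f l) p) (e (f k) p) := by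
          simp only [Matrix.mul_apply, Finset.mul_sum, M, Matrix.conjTranspose_apply,
            Matrix.of_apply, RCLike.inner_apply, star_mul', RCLike.star_def]
          refine Finset.sum_congr rfl fun p _ => ?_
          simp only [map_add, map_natCast, map_one]
          ring
      _ = _ := by
          rw [horth, Matrix.diagonal_apply]
          by_cases hkl : k = l
          · simp [hkl]
          · simp [hkl, hf.ne (Ne.symm hkl)]
  have hT : (Matrix.of fun p q : Fin a × Fin b => UA p.1 q.1 * UB p.2 q.2) ∈
      Matrix.unitaryGroup (Fin a × Fin b) ℂ := Matrix.kronecker_mem_unitary hA hB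
  have hUC : ∀ k l, k ≠ l → UC k l = 0 := fun k l hkl =>
    apply_eq_zero_of_mul_mul_eq hinj hMM hC hT h hkl
  have hrow : ∀ k q, UC k k * ∑ p, e (f k) p * (UA p.1 q.1 * UB p.2 q.2) = e (f k) q := by
    intro k q
    have hkq := congrFun (congrFun h k) q
    rw [Matrix.mul_assoc, Matrix.mul_apply, Finset.sum_eq_single k
      (fun l _ hl => by rw [hUC k l hl.symm, zero_mul]) (by simp), Matrix.mul_apply] at hkq
    simp only [M, Matrix.of_apply, mul_assoc, ← Finset.mul_sum] at hkq
    refine mul_left_cancel₀ (hk k) ?_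
    rw [← hkq]
    ring
  have hsingle : ∀ j, j ≠ 0 → ∃ d : ℂ, ∀ i' j',
      d * (UA (g j).1 i' * UB j j') = if (i', j') = ((g j).1, j) then 1 else 0 := by
    intro j hj
    obtain ⟨k, hkj⟩ := hfg j
    refine ⟨UC k k, fun i' j' => ?_⟩
    have := hrow k (i', j')
    rw [hkj, he _ (hg j hj).1 (hg j hj).2, Finset.sum_eq_single (g j)] at this
    · simpa [g, Pi.single_apply] using this
    · intro p _ hp
      simp [hp]
    · simp
  obtain ⟨k₀, hk₀⟩ := hfg 0
  obtain ⟨hA', hB'⟩ := eq_smul_one_of_fixes_cross hA hB (d := UC k₀ k₀)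
    (fun i hi => by
      have hi' : (i : ℕ) ≠ 0 := fun h => hi (Fin.ext (by simpa using h))
      have hgi : (g ⟨i, by omega⟩).1 = i := Fin.ext (by simp only [g]; omega)
      have := hsingle ⟨i, by omega⟩ fun h => hi' (by simpa using congrArg Fin.val h)
      rw [hgi] at this
      exact ⟨_, this⟩)
    (fun j hj => ⟨_, hsingle j hj⟩)
    (fun q => by
      have := hrow k₀ q
      rw [hk₀, hg₀, he₀] at this
      simp only [PiLp.smul_apply, smul_eq_mul, mul_assoc, ← Finset.mul_sum] at this
      refine mul_left_cancel₀ hr ?_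
      rw [← this]
      ring)
  refine ⟨⟨_, hA'⟩, ⟨_, hB'⟩, (UA 0 0 * UB 0 0)⁻¹, ?_⟩
  have hTq : ∀ p q : Fin a × Fin b,
      UA p.1 q.1 * UB p.2 q.2 = if p = q then UA 0 0 * UB 0 0 else 0 := by
    intro p q
    rw [hA', hB']
    by_cases h1 : p.1 = q.1 <;> by_cases h2 : p.2 = q.2 <;>
      simp [Prod.ext_iff, h1, h2]
  ext k l
  by_cases hkl : k = l
  · subst hkl
    obtain ⟨q, hq⟩ : ∃ q, e (f k) q ≠ 0 := by
      by_contra! hall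
      exact e.orthonormal.ne_zero (f k) (PiLp.ext hall)
    have := hrow k q
    simp only [hTq, mul_ite, mul_zero, Finset.sum_ite_eq', Finset.mem_univ, if_true] at this
    have h1 : UC k k * (UA 0 0 * UB 0 0) = 1 := mul_right_cancel₀ hq (by linear_combination this)
    simpa using eq_inv_of_mul_eq_one_left h1
  · simp [hUC k l hkl, hkl]

end
end

section
/- Let d be a positive integer. For every ψ ∈ ℂ^d ⊗ ℂ^d ⊗ ℂ^d, the polygonal inequality holds: the largest eigenvalue of ρ_A(ψ) plus the largest eigenvalue of ρ_B(ψ) is at most the trace of ρ_A(ψ) (which equals the squared norm of ψ) plus the largest eigenvalue of ρ_C(ψ). -/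
open scoped BigOperators

noncomputable section

lemma re_star_mul_self (z : ℂ) : (star z * z).re = ‖z‖ ^ 2 := by
  rw [Complex.star_def, ← Complex.normSq_eq_conj_mul_self, Complex.ofReal_re,
    Complex.normSq_eq_norm_sq]

/-- Pythagoras for the component of `f` orthogonal to a unit vector `v`. -/
lemma sum_norm_sq_sub_proj {ι : Type*} [Fintype ι] (v f : ι → ℂ) (hv : ∑ i, ‖v i‖ ^ 2 = 1) :
    ∑ i, ‖f i - v i * ∑ l, star (v l) * f l‖ ^ 2
      = ∑ i, ‖f i‖ ^ 2 - ‖∑ l, star (v l) * f l‖ ^ 2 := by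
  set s := ∑ l, star (v l) * f l with hs
  have key (i : ι) : ‖f i - v i * s‖ ^ 2
      = ‖f i‖ ^ 2 - 2 * (star s * (star (v i) * f i)).re + ‖v i‖ ^ 2 * ‖s‖ ^ 2 := by
    simp only [← Complex.normSq_eq_norm_sq, Complex.normSq_apply, Complex.star_def,
      Complex.sub_re, Complex.sub_im, Complex.mul_re, Complex.mul_im, Complex.conj_re,
      Complex.conj_im]
    ring
  rw [Finset.sum_congr rfl fun i _ => key i, Finset.sum_add_distrib, Finset.sum_sub_distrib,
    ← Finset.sum_mul, hv, ← Finset.mul_sum, ← Complex.re_sum, ← Finset.mul_sum, ← hs,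
    re_star_mul_self]
  ring

lemma norm_sq_sum_star_mul_le {ι : Type*} [Fintype ι] (v f : ι → ℂ)
    (hv : ∑ i, ‖v i‖ ^ 2 = 1) :
    ‖∑ l, star (v l) * f l‖ ^ 2 ≤ ∑ i, ‖f i‖ ^ 2 := by
  have h := sum_norm_sq_sub_proj v f hv
  have : 0 ≤ ∑ i, ‖f i - v i * ∑ l, star (v l) * f l‖ ^ 2 := by positivity
  linarith

/-- For commuting rank-one-type projections `P`, `Q` acting on rows and columns,
`P + Q ≤ 1 + P Q`. -/
lemma sum_norm_sq_contract_add_le {ι κ : Type*} [Fintype ι] [Fintype κ] (u : ι → ℂ) (v : κ → ℂ)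
    (hu : ∑ i, ‖u i‖ ^ 2 = 1) (hv : ∑ j, ‖v j‖ ^ 2 = 1) (M : ι → κ → ℂ) :
    ∑ j, ‖∑ i, star (u i) * M i j‖ ^ 2 + ∑ i, ‖∑ j, star (v j) * M i j‖ ^ 2
      ≤ ∑ i, ∑ j, ‖M i j‖ ^ 2 + ‖∑ j, star (v j) * ∑ i, star (u i) * M i j‖ ^ 2 := by
  have hrow := Finset.sum_congr rfl fun i (_ : i ∈ Finset.univ) =>
    sum_norm_sq_sub_proj v (M i) hv
  have hcol := sum_norm_sq_sub_proj v (fun j => ∑ i, star (u i) * M i j) hv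
  have hbessel := Finset.sum_le_sum fun j (_ : j ∈ Finset.univ) =>
    norm_sq_sum_star_mul_le u (fun i => M i j - v j * ∑ l, star (v l) * M i l) hu
  have hcontract (j : κ) : ∑ i, star (u i) * (M i j - v j * ∑ l, star (v l) * M i l)
      = (∑ i, star (u i) * M i j) - v j * ∑ l, star (v l) * ∑ i, star (u i) * M i l := by
    simp only [mul_sub, Finset.sum_sub_distrib, Finset.mul_sum]
    congr 1
    rw [Finset.sum_comm]
    exact Finset.sum_congr rfl fun _ _ => Finset.sum_congr rfl fun _ _ => by ring
  simp only [hcontract] at hbessel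
  rw [Finset.sum_comm, hrow, hcol, Finset.sum_sub_distrib] at hbessel
  linarith

lemma re_dotProduct_mul_conjTranspose_mulVec {m n : Type*} [Fintype m] [Fintype n]
    (G : Matrix m n ℂ) (x : m → ℂ) :
    (star x ⬝ᵥ (G * G.conjTranspose).mulVec x).re
      = ∑ p, ‖∑ i, star (x i) * G i p‖ ^ 2 := by
  have h : G.conjTranspose.mulVec x = star (Matrix.vecMul (star x) G) := by
    rw [Matrix.star_vecMul, star_star]
  rw [← Matrix.mulVec_mulVec, Matrix.dotProduct_mulVec, h, dotProduct, Complex.re_sum]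
  refine Finset.sum_congr rfl fun p _ => ?_
  rw [Pi.star_apply, mul_comm, re_star_mul_self]
  rfl

lemma IsSpecDown.exists_unit_vector {n : ℕ} {ρ : Matrix (Fin n) (Fin n) ℂ} {lam : Fin n → ℝ}
    (h : IsSpecDown ρ lam) (i : Fin n) :
    ∃ u : Fin n → ℂ, ∑ l, ‖u l‖ ^ 2 = 1 ∧ (star u ⬝ᵥ ρ.mulVec u).re = lam i := by
  obtain ⟨-, hρ, σ, rfl⟩ := h
  refine ⟨hρ.eigenvectorBasis (σ i), ?_, (hρ.eigenvalues_eq (σ i)).symm⟩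
  rw [← EuclideanSpace.norm_sq_eq, hρ.eigenvectorBasis.orthonormal.1, one_pow]

open scoped ComplexOrder in
lemma IsSpecDown.re_dotProduct_mulVec_le {n : ℕ} {ρ : Matrix (Fin n) (Fin n) ℂ}
    {lam : Fin n → ℝ} (h : IsSpecDown ρ lam) (hn : 0 < n) (x : Fin n → ℂ) :
    (star x ⬝ᵥ ρ.mulVec x).re ≤ lam ⟨0, hn⟩ * ∑ l, ‖x l‖ ^ 2 := by
  obtain ⟨hanti, hρ, σ, rfl⟩ := h
  set μ := (hρ.eigenvalues ∘ σ) ⟨0, hn⟩ with hμ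
  have hle (i : Fin n) : hρ.eigenvalues i ≤ μ := by
    have : (⟨0, hn⟩ : Fin n) ≤ σ.symm i := Fin.mk_le_of_le_val (Nat.zero_le _)
    simpa [hμ] using hanti this
  have hdiag : (Matrix.diagonal fun i => ((μ - hρ.eigenvalues i : ℝ) : ℂ)).PosSemidef :=
    Matrix.PosSemidef.diagonal fun i =>
      Complex.zero_le_real.2 (sub_nonneg.2 (hle i))
  have hpos := hdiag.mul_mul_conjTranspose_same (hρ.eigenvectorUnitary : Matrix (Fin n) (Fin n) ℂ)
  have hU : (hρ.eigenvectorUnitary : Matrix (Fin n) (Fin n) ℂ)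
      * (hρ.eigenvectorUnitary : Matrix (Fin n) (Fin n) ℂ).conjTranspose = 1 :=
    Unitary.mul_star_self_of_mem hρ.eigenvectorUnitary.2
  have hspec : (hρ.eigenvectorUnitary : Matrix (Fin n) (Fin n) ℂ)
      * (Matrix.diagonal fun i => ((hρ.eigenvalues i : ℝ) : ℂ))
      * (hρ.eigenvectorUnitary : Matrix (Fin n) (Fin n) ℂ).conjTranspose = ρ :=
    hρ.spectral_theorem.symm
  have hsplit : (Matrix.diagonal fun i => ((μ - hρ.eigenvalues i : ℝ) : ℂ))
      = (μ : ℂ) • (1 : Matrix (Fin n) (Fin n) ℂ)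
        - Matrix.diagonal fun i => ((hρ.eigenvalues i : ℝ) : ℂ) := by
    rw [Matrix.smul_one_eq_diagonal, Matrix.diagonal_sub]
    simp
  rw [hsplit, mul_sub, sub_mul, hspec, mul_smul_comm, mul_one, smul_mul_assoc, hU] at hpos
  have hquad := (Complex.le_def.1 (hpos.dotProduct_mulVec_nonneg x)).1
  have hxx : (star x ⬝ᵥ x).re = ∑ l, ‖x l‖ ^ 2 := by
    rw [dotProduct, Complex.re_sum]
    exact Finset.sum_congr rfl fun l _ => re_star_mul_self (x l)
  rw [Matrix.sub_mulVec, Matrix.smul_mulVec, Matrix.one_mulVec, dotProduct_sub, dotProduct_smul,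
    smul_eq_mul, Complex.sub_re, Complex.re_ofReal_mul, hxx, Complex.zero_re] at hquad
  linarith

section ReducedDensity

variable {a b c : ℕ} (ψ : Fin a × Fin b × Fin c → ℂ)

lemma re_dotProduct_rhoA_mulVec (x : Fin a → ℂ) :
    (star x ⬝ᵥ (rhoA ψ).mulVec x).re = ∑ j, ∑ k, ‖∑ i, star (x i) * ψ (i, j, k)‖ ^ 2 := by
  have h : rhoA ψ = (Matrix.of fun i (p : Fin b × Fin c) => ψ (i, p.1, p.2))
      * (Matrix.of fun i (p : Fin b × Fin c) => ψ (i, p.1, p.2)).conjTranspose := by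
    ext i i'
    simp [rhoA, Matrix.mul_apply, Fintype.sum_prod_type]
  rw [h, re_dotProduct_mul_conjTranspose_mulVec, Fintype.sum_prod_type]
  rfl

lemma re_dotProduct_rhoB_mulVec (x : Fin b → ℂ) :
    (star x ⬝ᵥ (rhoB ψ).mulVec x).re = ∑ i, ∑ k, ‖∑ j, star (x j) * ψ (i, j, k)‖ ^ 2 := by
  have h : rhoB ψ = (Matrix.of fun j (p : Fin a × Fin c) => ψ (p.1, j, p.2))
      * (Matrix.of fun j (p : Fin a × Fin c) => ψ (p.1, j, p.2)).conjTranspose := by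
    ext j j'
    simp [rhoB, Matrix.mul_apply, Fintype.sum_prod_type]
  rw [h, re_dotProduct_mul_conjTranspose_mulVec, Fintype.sum_prod_type]
  rfl

lemma re_dotProduct_rhoC_mulVec (x : Fin c → ℂ) :
    (star x ⬝ᵥ (rhoC ψ).mulVec x).re = ∑ i, ∑ j, ‖∑ k, star (x k) * ψ (i, j, k)‖ ^ 2 := by
  have h : rhoC ψ = (Matrix.of fun k (p : Fin a × Fin b) => ψ (p.1, p.2, k))
      * (Matrix.of fun k (p : Fin a × Fin b) => ψ (p.1, p.2, k)).conjTranspose := by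
    ext k k'
    simp [rhoC, Matrix.mul_apply, Fintype.sum_prod_type]
  rw [h, re_dotProduct_mul_conjTranspose_mulVec, Fintype.sum_prod_type]
  rfl

lemma re_trace_rhoA : ((rhoA ψ).trace).re = ∑ i, ∑ j, ∑ k, ‖ψ (i, j, k)‖ ^ 2 := by
  simp only [Matrix.trace, Matrix.diag_apply, rhoA, Matrix.of_apply, Complex.re_sum,
    Complex.mul_conj, Complex.ofReal_re, Complex.normSq_eq_norm_sq]

/-- Contracting `ψ` with unit vectors in the first two factors yields a vector whose squared norm
is at most the largest eigenvalue of `rhoC ψ`. -/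
lemma IsSpecDown.sum_norm_sq_contract_le {lam : Fin c → ℝ} (h : IsSpecDown (rhoC ψ) lam)
    (hc : 0 < c) (u : Fin a → ℂ) (v : Fin b → ℂ)
    (hu : ∑ i, ‖u i‖ ^ 2 = 1) (hv : ∑ j, ‖v j‖ ^ 2 = 1) :
    ∑ k, ‖∑ j, star (v j) * ∑ i, star (u i) * ψ (i, j, k)‖ ^ 2 ≤ lam ⟨0, hc⟩ := by
  set w : Fin c → ℂ := fun k => ∑ j, star (v j) * ∑ i, star (u i) * ψ (i, j, k) with hw
  change ∑ k, ‖w k‖ ^ 2 ≤ _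
  set N := ∑ k, ‖w k‖ ^ 2 with hN
  have hN0 : 0 ≤ N := by positivity
  have hswap : ∑ j, star (v j) * ∑ i, star (u i) * ∑ k, star (w k) * ψ (i, j, k) = (N : ℂ) := by
    have h1 : (N : ℂ) = ∑ k, star (w k) * w k := by
      rw [hN, Complex.ofReal_sum]
      refine Finset.sum_congr rfl fun k _ => ?_
      rw [Complex.star_def, ← Complex.normSq_eq_conj_mul_self, Complex.normSq_eq_norm_sq]
    rw [h1]
    conv_rhs => enter [2, k, 2]; rw [hw]
    simp only [Finset.mul_sum]
    rw [Finset.sum_comm (s := (Finset.univ : Finset (Fin c)))]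
    refine Finset.sum_congr rfl fun j _ => ?_
    rw [Finset.sum_comm (s := (Finset.univ : Finset (Fin c)))]
    exact Finset.sum_congr rfl fun _ _ => Finset.sum_congr rfl fun _ _ => by ring
  have hsq : N ^ 2 ≤ lam ⟨0, hc⟩ * N := calc
    N ^ 2 = ‖(N : ℂ)‖ ^ 2 := by simp
    _ ≤ ∑ j, ‖∑ i, star (u i) * ∑ k, star (w k) * ψ (i, j, k)‖ ^ 2 :=
      hswap ▸ norm_sq_sum_star_mul_le v _ hv
    _ ≤ ∑ j, ∑ i, ‖∑ k, star (w k) * ψ (i, j, k)‖ ^ 2 :=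
      Finset.sum_le_sum fun j _ => norm_sq_sum_star_mul_le u _ hu
    _ = (star w ⬝ᵥ (rhoC ψ).mulVec w).re := by
      rw [Finset.sum_comm, re_dotProduct_rhoC_mulVec]
    _ ≤ lam ⟨0, hc⟩ * N := h.re_dotProduct_mulVec_le hc w
  rcases hN0.eq_or_lt with h0 | hlt
  · obtain ⟨x, -, hx⟩ := h.exists_unit_vector ⟨0, hc⟩
    rw [← h0, ← hx, re_dotProduct_rhoC_mulVec]
    positivity
  · nlinarith

end ReducedDensity

/-- the polygonal inequality
`λ_{A,1} + λ_{B,1} ≤ |λ| + λ_{C,1}`. -/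
theorem polygonal_inequality (d : ℕ) (hd : 0 < d)
    (ψ : Fin d × Fin d × Fin d → ℂ)
    (lamA lamB lamC : Fin d → ℝ)
    (hA : IsSpecDown (rhoA ψ) lamA) (hB : IsSpecDown (rhoB ψ) lamB)
    (hC : IsSpecDown (rhoC ψ) lamC) :
    lamA ⟨0, hd⟩ + lamB ⟨0, hd⟩ ≤ ((rhoA ψ).trace).re + lamC ⟨0, hd⟩ := by
  obtain ⟨u, hu, hAu⟩ := hA.exists_unit_vector ⟨0, hd⟩
  obtain ⟨v, hv, hBv⟩ := hB.exists_unit_vector ⟨0, hd⟩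
  have hw := hC.sum_norm_sq_contract_le ψ hd u v hu hv
  have hslice := Finset.sum_le_sum fun k (_ : k ∈ Finset.univ) =>
    sum_norm_sq_contract_add_le u v hu hv fun i j => ψ (i, j, k)
  have hnorm : ∑ i, ∑ j, ∑ k, ‖ψ (i, j, k)‖ ^ 2 = ∑ k, ∑ i, ∑ j, ‖ψ (i, j, k)‖ ^ 2 := by
    rw [Finset.sum_comm (s := (Finset.univ : Finset (Fin d)))
      (f := fun k i => ∑ j, ‖ψ (i, j, k)‖ ^ 2)]
    exact Finset.sum_congr rfl fun i _ => Finset.sum_comm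
  rw [Finset.sum_add_distrib, Finset.sum_add_distrib] at hslice
  rw [re_dotProduct_rhoA_mulVec, Finset.sum_comm] at hAu
  rw [re_dotProduct_rhoB_mulVec, Finset.sum_comm] at hBv
  rw [← hAu, ← hBv, re_trace_rhoA, hnorm]
  linarith

end
end
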